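/- For every integer n ≥ 2, the set of real numbers α such that A^{∘α} is positive semidefinite for every n×n real symmetric positive semidefinite matrix A with nonnegative entries equals ℕ ∪ [n−2, ∞) (where ℕ denotes the positive integers). -/

import Mathlib

open Matrix

/-- Entrywise power with the convention `0 ^ α := 0` for all `α`. -/
noncomputable def powF (α x : ℝ) : ℝ := if x = 0 then 0 else x ^ α

/-- `ψ_α(x) := sgn(x) * |x| ^ α`, with `ψ_α(0) := 0`. -/
noncomputable def psiF (α x : ℝ) : ℝ := if x = 0 then 0 else Real.sign x * |x| ^ α

/-- `φ_α(x) := |x| ^ α`, with `φ_α(0) := 0`. -/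
noncomputable def phiF (α x : ℝ) : ℝ := if x = 0 then 0 else |x| ^ α

lemma psd_iff' {n : ℕ} (M : Matrix (Fin n) (Fin n) ℝ) : M.PosSemidef ↔
    (∀ i j, M i j = M j i) ∧ ∀ x : Fin n → ℝ, 0 ≤ ∑ i, ∑ j, x i * M i j * x j := by
  rw [posSemidef_iff_dotProduct_mulVec]
  refine and_congr ?_ (forall_congr' fun x => ?_)
  · constructor
    · intro h i j
      have := congrFun (congrFun h j) i
      simpa using this
    · intro h
      ext i j
      simpa using h j i
  · simp [dotProduct, mulVec, Finset.mul_sum, mul_assoc]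

lemma quad_two {n : ℕ} {A : Matrix (Fin n) (Fin n) ℝ} (hA : A.PosSemidef)
    (x : Fin n → ℝ) (k : Fin n) (s : ℝ) :
    0 ≤ (∑ i, ∑ j, x i * A i j * x j) + 2 * s * (∑ i, x i * A i k) + s ^ 2 * A k k := by
  obtain ⟨hs, hq⟩ := (psd_iff' A).1 hA
  have h := hq (fun i => x i + s * (if i = k then 1 else 0))
  have e : ∀ i j, (x i + s * (if i = k then 1 else 0)) * A i j *
      (x j + s * (if j = k then 1 else 0)) = x i * A i j * x j
        + (if i = k then s * A i j * x j else 0) + (if j = k then s * (x i * A i j) else 0)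
        + (if i = k then (if j = k then s ^ 2 * A i j else 0) else 0) := by
    intro i j
    split_ifs <;> ring
  simp only [e, Finset.sum_add_distrib, Finset.sum_ite_eq', Finset.mem_univ, if_true] at h
  have e2 : ∑ i, ∑ j, (if i = k then s * A i j * x j else 0) = s * ∑ i, x i * A i k := by
    rw [Finset.sum_comm]
    simp only [Finset.sum_ite_eq', Finset.mem_univ, if_true, Finset.mul_sum]
    refine Finset.sum_congr rfl fun i _ => ?_
    rw [hs k i]; ring
  have e3 : ∑ i, (if i = k then (∑ j, if j = k then s ^ 2 * A i j else 0) else 0)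
      = s ^ 2 * A k k := by simp
  have e4 : ∑ i, ∑ j, (if i = k then (if j = k then s ^ 2 * A i j else 0) else 0)
      = s ^ 2 * A k k := by
    rw [Finset.sum_comm]; simp
  rw [e2, e4, ← Finset.mul_sum] at h
  linarith

lemma minor_le {n : ℕ} {A : Matrix (Fin n) (Fin n) ℝ} (hA : A.PosSemidef) (i j : Fin n) :
    A i j ^ 2 ≤ A i i * A j j := by
  have h : ∀ s t : ℝ, 0 ≤ t ^ 2 * A i i + 2 * s * t * A i j + s ^ 2 * A j j := by
    intro s t
    have := quad_two hA (fun k => if k = i then t else 0) j s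
    simp at this
    nlinarith
  have hi : 0 ≤ A i i := hA.diag_nonneg
  have hj : 0 ≤ A j j := hA.diag_nonneg
  rcases hi.eq_or_lt with h0 | h0
  · have h1 := h (-A i j) ((A j j + 1) / 2)
    have h2 := h (-A i j) ((A j j + 1))
    rw [← h0] at h1 h2 ⊢
    nlinarith
  · have h1 := h (A i i) (-A i j)
    by_contra hc
    push Not at hc
    nlinarith

lemma powF_nonneg' (α : ℝ) {x : ℝ} (hx : 0 ≤ x) : 0 ≤ powF α x := by
  unfold powF; split_ifs
  · exact le_rfl
  · exact Real.rpow_nonneg hx α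

lemma powF_of_ne {α : ℝ} (h : α ≠ 0) (x : ℝ) : powF α x = x ^ α := by
  unfold powF; split_ifs with h0
  · rw [h0, Real.zero_rpow h]
  · rfl

lemma base_case (α : ℝ) (hα : 0 ≤ α) (A : Matrix (Fin 2) (Fin 2) ℝ) (hA : A.PosSemidef)
    (hn : ∀ i j, 0 ≤ A i j) : (A.map (powF α)).PosSemidef := by
  have hs := ((psd_iff' A).1 hA).1
  rw [psd_iff']
  refine ⟨fun i j => by simp [hs i j], fun x => ?_⟩
  simp only [Fin.sum_univ_two, Matrix.map_apply]
  rw [hs 1 0]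
  have ha := powF_nonneg' α (hn 0 0)
  have hc := powF_nonneg' α (hn 1 1)
  have key : powF α (A 0 1) ^ 2 ≤ powF α (A 0 0) * powF α (A 1 1) := by
    by_cases hb : A 0 1 = 0
    · have h0 : powF α (A 0 1) = 0 := by simp [hb, powF]
      rw [h0]
      simpa using mul_nonneg ha hc
    · have hm := minor_le hA 0 1
      have hb' : 0 < A 0 1 := lt_of_le_of_ne (hn 0 1) (Ne.symm hb)
      have hpos : 0 < A 0 0 * A 1 1 := lt_of_lt_of_le (by positivity) hm
      have h0 : A 0 0 ≠ 0 := fun h => by rw [h, zero_mul] at hpos; exact lt_irrefl _ hpos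
      have h1 : A 1 1 ≠ 0 := fun h => by rw [h, mul_zero] at hpos; exact lt_irrefl _ hpos
      simp only [powF, hb, h0, h1, if_false]
      rw [← Real.mul_rpow (hn 0 0) (hn 1 1), sq, ← Real.mul_rpow (hn 0 1) (hn 0 1), ← sq]
      exact Real.rpow_le_rpow (by positivity) hm hα
  set a := powF α (A 0 0)
  set b := powF α (A 0 1)
  set c := powF α (A 1 1)
  rcases ha.eq_or_lt with h | h
  · have hb : b = 0 := by
      have : b ^ 2 ≤ 0 := by rw [← h] at key; simpa using key
      exact pow_eq_zero_iff (two_ne_zero) |>.1 (le_antisymm this (sq_nonneg b))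
    rw [← h, hb]
    have := mul_nonneg hc (sq_nonneg (x 1))
    nlinarith
  · have : 0 ≤ a * (x 0 * a * x 0 + x 0 * b * x 1 + (x 1 * b * x 0 + x 1 * c * x 1)) := by
      have h1 : 0 ≤ (a * c - b ^ 2) * x 1 ^ 2 := mul_nonneg (by linarith) (sq_nonneg _)
      nlinarith [sq_nonneg (a * x 0 + b * x 1)]
    exact nonneg_of_mul_nonneg_right this h

lemma forward (n : ℕ) : ∀ α : ℝ, (n : ℝ) ≤ α → ∀ A : Matrix (Fin (n + 2)) (Fin (n + 2)) ℝ,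
    A.PosSemidef → (∀ i j, 0 ≤ A i j) → (A.map (powF α)).PosSemidef := by
  induction n with
  | zero => intro α hα A hA hn; exact base_case α (by simpa using hα) A hA hn
  | succ n ih =>
    intro α hα A hA hn
    push_cast at hα
    have hn0 : (0 : ℝ) ≤ n := Nat.cast_nonneg n
    rcases (show (1 : ℝ) ≤ α by linarith).eq_or_lt with h1 | h1
    · have : A.map (powF α) = A := by
        ext i j
        simp [← h1, powF_of_ne]
      rwa [this]
    have hs := ((psd_iff' A).1 hA).1
    set a := A 0 0 with ha
    have ha0 : 0 ≤ a := hn 0 0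
    -- rank one part and Schur complement
    let E : Matrix (Fin (n + 3)) (Fin (n + 3)) ℝ := fun i j => A i 0 * A j 0 / a
    let B : Matrix (Fin (n + 3)) (Fin (n + 3)) ℝ := fun i j => A i j - A i 0 * A j 0 / a
    have hE0 : ∀ i j, 0 ≤ E i j := fun i j => div_nonneg (mul_nonneg (hn _ _) (hn _ _)) ha0
    have hEpsd : E.PosSemidef := by
      rw [psd_iff']
      refine ⟨fun i j => by simp only [E]; ring, fun x => ?_⟩
      have : ∑ i, ∑ j, x i * E i j * x j = (∑ i, x i * A i 0) ^ 2 / a := by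
        rw [sq, Finset.sum_mul_sum, Finset.sum_div]
        refine Finset.sum_congr rfl fun i _ => ?_
        rw [Finset.sum_div]
        refine Finset.sum_congr rfl fun j _ => ?_
        simp only [E]; ring
      rw [this]; positivity
    have hBpsd : B.PosSemidef := by
      rw [psd_iff']
      refine ⟨fun i j => by simp only [B]; rw [hs i j]; ring, fun x => ?_⟩
      have e : ∑ i, ∑ j, x i * B i j * x j
          = (∑ i, ∑ j, x i * A i j * x j) - (∑ i, x i * A i 0) ^ 2 / a := by
        rw [sq, Finset.sum_mul_sum, Finset.sum_div, ← Finset.sum_sub_distrib]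
        refine Finset.sum_congr rfl fun i _ => ?_
        rw [Finset.sum_div, ← Finset.sum_sub_distrib]
        refine Finset.sum_congr rfl fun j _ => ?_
        simp only [B]; ring
      have h := quad_two hA x 0 (-(∑ i, x i * A i 0) / a)
      rw [e]
      refine h.trans_eq ?_
      rw [← ha]
      by_cases h0 : a = 0
      · simp [h0]
      · field_simp; ring
    have hB0 : ∀ j, B 0 j = 0 := by
      intro j
      simp only [B]
      by_cases h0 : a = 0
      · have := minor_le hA 0 j
        rw [← ha, h0, zero_mul] at this
        have h2 : A 0 j = 0 := pow_eq_zero_iff two_ne_zero |>.1 (le_antisymm this (sq_nonneg _))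
        simp [h0, h2]
      · rw [← ha, hs 0 j]; field_simp; ring
    have hB0' : ∀ j, B j 0 = 0 := fun j => by
      rw [((psd_iff' B).1 hBpsd).1 j 0, hB0]
    have hA' : ∀ i j, A i j = E i j + 1 * B i j := fun i j => by simp only [E, B]; ring
    rw [psd_iff']
    refine ⟨fun i j => by simp [hs i j], fun x => ?_⟩
    simp only [Matrix.map_apply, powF_of_ne (show α ≠ 0 by linarith)]
    let g : ℝ → ℝ := fun t => ∑ i, ∑ j, x i * (E i j + t * B i j) ^ α * x j
    let g' : ℝ → ℝ := fun t => ∑ i, ∑ j,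
      x i * (B i j * α * (E i j + t * B i j) ^ (α - 1)) * x j
    have hg : ∀ t, HasDerivAt g (g' t) t := by
      intro t
      refine HasDerivAt.fun_sum fun i _ => HasDerivAt.fun_sum fun j _ => ?_
      refine HasDerivAt.mul_const (HasDerivAt.const_mul _ ?_) _
      refine HasDerivAt.rpow_const ?_ (Or.inr h1.le)
      simpa using ((hasDerivAt_id t).mul_const (B i j)).const_add (E i j)
    have hg' : ∀ t ∈ Set.Icc (0 : ℝ) 1, 0 ≤ g' t := by
      intro t ht
      let C : Matrix (Fin (n + 3)) (Fin (n + 3)) ℝ := E + t • B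
      have hC : C.PosSemidef := hEpsd.add (hBpsd.smul ht.1)
      have hCn : ∀ i j, 0 ≤ C i j := by
        intro i j
        have : C i j = (1 - t) * E i j + t * A i j := by
          rw [hA' i j]; simp only [C, Matrix.add_apply, Matrix.smul_apply, smul_eq_mul]; ring
        rw [this]
        exact add_nonneg (mul_nonneg (by linarith [ht.2]) (hE0 i j)) (mul_nonneg ht.1 (hn i j))
      have h3 := ih (α - 1) (by linarith) (C.submatrix Fin.succ Fin.succ) (hC.submatrix _)
        (fun i j => hCn _ _)
      have h4 := (hBpsd.submatrix (Fin.succ : Fin (n + 2) → _)).hadamard h3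
      have h5 := ((psd_iff' _).1 h4).2 (fun i => x i.succ)
      have h6 : g' t = α * ∑ i : Fin (n + 2), ∑ j : Fin (n + 2), x i.succ *
          ((B.submatrix (Fin.succ : Fin (n + 2) → _) Fin.succ) ⊙
            ((C.submatrix Fin.succ Fin.succ).map (powF (α - 1)))) i j * x j.succ := by
        simp only [g']
        rw [Fin.sum_univ_succ]
        simp only [hB0, zero_mul, mul_zero, Finset.sum_const_zero, zero_add]
        rw [Finset.mul_sum]
        refine Finset.sum_congr rfl fun i _ => ?_
        rw [Fin.sum_univ_succ, hB0', Finset.mul_sum]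
        simp only [zero_mul, mul_zero, zero_add]
        refine Finset.sum_congr rfl fun j _ => ?_
        simp only [Matrix.hadamard_apply, Matrix.map_apply, Matrix.submatrix_apply,
          powF_of_ne (show α - 1 ≠ 0 by linarith), C, Matrix.add_apply, Matrix.smul_apply,
          smul_eq_mul]
        ring
      rw [h6]
      exact mul_nonneg (by linarith) h5
    have hmono : MonotoneOn g (Set.Icc 0 1) := by
      refine monotoneOn_of_deriv_nonneg (convex_Icc 0 1)
        (fun t _ => (hg t).continuousAt.continuousWithinAt)
        (fun t _ => (hg t).differentiableAt.differentiableWithinAt) fun t ht => ?_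
      rw [(hg t).deriv]
      exact hg' t (interior_subset ht)
    have h01 := hmono (Set.left_mem_Icc.2 zero_le_one) (Set.right_mem_Icc.2 zero_le_one) zero_le_one
    have hg0 : g 0 = (∑ i, x i * (A i 0) ^ α) ^ 2 / a ^ α := by
      simp only [g]
      rw [sq, Finset.sum_mul_sum, Finset.sum_div]
      refine Finset.sum_congr rfl fun i _ => ?_
      rw [Finset.sum_div]
      refine Finset.sum_congr rfl fun j _ => ?_
      simp only [E, zero_mul, add_zero]
      rw [Real.div_rpow (mul_nonneg (hn _ _) (hn _ _)) ha0, Real.mul_rpow (hn _ _) (hn _ _)]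
      ring
    have : 0 ≤ g 0 := by
      rw [hg0]; exact div_nonneg (sq_nonneg _) (Real.rpow_nonneg ha0 _)
    calc 0 ≤ g 1 := this.trans h01
      _ = _ := by simp only [g, hA']

lemma nat_power {n : ℕ} (k : ℕ) (A : Matrix (Fin n) (Fin n) ℝ) (hA : A.PosSemidef) :
    (A.map (fun x => x ^ (k + 1))).PosSemidef := by
  induction k with
  | zero => simpa using hA
  | succ k ih =>
    have := ih.hadamard hA
    have e : (A.map fun x => x ^ (k + 1 + 1)) = (A.map fun x => x ^ (k + 1)) ⊙ A := by
      ext i j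
      simp [pow_succ]
    rw [e]
    exact this

lemma moment (n m k : ℕ) (hmn : m + 1 ≤ n) :
    ∑ i : Fin n, ((-1 : ℝ) ^ (m - (i : ℕ)) * (m.choose i)) * (i : ℝ) ^ k
      = (fwdDiff (1 : ℝ))^[m] (fun r : ℝ => r ^ k) 0 := by
  rw [fwdDiff_iter_eq_sum_shift,
    Fin.sum_univ_eq_sum_range (fun i => ((-1 : ℝ) ^ (m - i) * (m.choose i)) * (i : ℝ) ^ k) n]
  symm
  have : Finset.range (m + 1) ⊆ Finset.range n := Finset.range_subset_range.2 hmn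
  rw [← Finset.sum_subset this]
  · refine Finset.sum_congr rfl fun i _ => ?_
    simp
  · intro i _ hi
    have : m < i := by simpa using hi
    simp [Nat.choose_eq_zero_of_lt this]

lemma remainder (α : ℝ) (m : ℕ) (c : ℝ) :
    Filter.Tendsto (fun t : ℝ => ((1 + t * c) ^ α -
      ∑ k ∈ Finset.range (m + 1), Ring.choose α k * (t * c) ^ k) / t ^ m)
      (nhdsWithin 0 (Set.Ioi 0)) (nhds 0) := by
  have h := (Real.one_add_rpow_hasFPowerSeriesAt_zero (a := α)).isBigO_sub_partialSum_pow (m + 1)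
  have h2 : Filter.Tendsto (fun t : ℝ => t * c) (nhdsWithin 0 (Set.Ioi 0)) (nhds 0) := by
    have : Filter.Tendsto (fun t : ℝ => t * c) (nhds 0) (nhds (0 * c)) :=
      (continuous_id.mul continuous_const).tendsto 0
    rw [zero_mul] at this
    exact this.mono_left nhdsWithin_le_nhds
  have h3 := h.comp_tendsto h2
  have h4 : (fun t : ℝ => ‖t * c‖ ^ (m + 1)) =O[nhdsWithin 0 (Set.Ioi 0)]
      fun t : ℝ => t ^ (m + 1) := by
    refine Asymptotics.IsBigO.of_bound (|c| ^ (m + 1)) (Filter.Eventually.of_forall fun t => ?_)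
    simp [mul_pow, mul_comm]
  have h5 : (fun t : ℝ => t ^ (m + 1)) =o[nhdsWithin 0 (Set.Ioi 0)] fun t : ℝ => t ^ m :=
    (Asymptotics.isLittleO_pow_pow (Nat.lt_succ_self m)).mono nhdsWithin_le_nhds
  have h6 := ((h3.trans h4).trans_isLittleO h5).tendsto_div_nhds_zero
  refine h6.congr fun t => ?_
  simp [FormalMultilinearSeries.partialSum, binomialSeries,
    FormalMultilinearSeries.coeff_ofScalars, mul_comm]

lemma not_preserve (n m : ℕ) (hmn : m + 1 ≤ n) (α : ℝ) (hc : Ring.choose α m < 0) :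
    ¬ ∀ A : Matrix (Fin n) (Fin n) ℝ, A.PosSemidef → (∀ i j, 0 ≤ A i j) →
        (A.map (powF α)).PosSemidef := by
  intro H
  let x : Fin n → ℝ := fun i => (-1 : ℝ) ^ (m - (i : ℕ)) * (m.choose i)
  have hx0 : ∀ k < m, ∑ i, x i * (i : ℝ) ^ k = 0 := by
    intro k hk
    simp only [x]
    rw [moment n m k hmn, fwdDiff_iter_pow_eq_zero_of_lt hk]; rfl
  have hxm : ∑ i, x i * (i : ℝ) ^ m = (m.factorial : ℝ) := by
    simp only [x]
    rw [moment n m m hmn, fwdDiff_iter_eq_factorial]; rfl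
  let R : ℝ → ℝ → ℝ := fun c t => ((1 + t * c) ^ α -
      ∑ k ∈ Finset.range (m + 1), Ring.choose α k * (t * c) ^ k) / t ^ m
  have hR : Filter.Tendsto (fun t => Ring.choose α m * (m.factorial : ℝ) ^ 2 +
      ∑ i : Fin n, ∑ j : Fin n, x i * x j * R ((i : ℝ) * j) t) (nhdsWithin 0 (Set.Ioi 0))
      (nhds (Ring.choose α m * (m.factorial : ℝ) ^ 2 +
        ∑ i : Fin n, ∑ j : Fin n, x i * x j * 0)) := by
    refine tendsto_const_nhds.add ?_
    refine tendsto_finsetSum _ fun i _ => tendsto_finsetSum _ fun j _ => ?_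
    exact (remainder α m _).const_mul _
  have hneg : Ring.choose α m * (m.factorial : ℝ) ^ 2 +
        ∑ i : Fin n, ∑ j : Fin n, x i * x j * 0 < 0 := by
    simp only [mul_zero, Finset.sum_const_zero, add_zero]
    exact mul_neg_of_neg_of_pos hc (by positivity)
  obtain ⟨t, ht1, ht2⟩ := ((hR.eventually_lt_const hneg).and self_mem_nhdsWithin).exists
  have ht : 0 < t := ht2
  let A : Matrix (Fin n) (Fin n) ℝ := fun i j => 1 + t * ((i : ℝ) * j)
  have hApos : ∀ i j, 0 < A i j := fun i j => by simp only [A]; positivity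
  have hA : A.PosSemidef := by
    rw [psd_iff']
    refine ⟨fun i j => by simp only [A]; ring, fun y => ?_⟩
    have : ∑ i, ∑ j, y i * A i j * y j = (∑ i, y i) ^ 2 + t * (∑ i, y i * (i : ℝ)) ^ 2 := by
      rw [sq, sq, Finset.sum_mul_sum, Finset.sum_mul_sum, Finset.mul_sum,
        ← Finset.sum_add_distrib]
      refine Finset.sum_congr rfl fun i _ => ?_
      rw [Finset.mul_sum, ← Finset.sum_add_distrib]
      refine Finset.sum_congr rfl fun j _ => ?_
      simp only [A]; ring
    rw [this]; positivity
  have h1 := ((psd_iff' _).1 (H A hA fun i j => (hApos i j).le)).2 x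
  have h2 : ∀ i j : Fin n, x i * (A.map (powF α)) i j * x j =
      (∑ k ∈ Finset.range (m + 1), Ring.choose α k * t ^ k *
        ((x i * (i : ℝ) ^ k) * (x j * (j : ℝ) ^ k))) +
        t ^ m * (x i * x j * R ((i : ℝ) * j) t) := by
    intro i j
    have e1 : t ^ m * (x i * x j * R ((i : ℝ) * j) t) = x i * x j * ((1 + t * ((i : ℝ) * j)) ^ α -
        ∑ k ∈ Finset.range (m + 1), Ring.choose α k * (t * ((i : ℝ) * j)) ^ k) := by
      simp only [R]; field_simp
    rw [e1, mul_sub, Finset.mul_sum]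
    have e2 : (A.map (powF α)) i j = (1 + t * ((i : ℝ) * j)) ^ α := by
      simp only [Matrix.map_apply, powF, (hApos i j).ne', if_false]; rfl
    have e3 : ∑ k ∈ Finset.range (m + 1), Ring.choose α k * t ^ k *
        ((x i * (i : ℝ) ^ k) * (x j * (j : ℝ) ^ k)) =
        ∑ k ∈ Finset.range (m + 1), x i * x j * (Ring.choose α k * (t * ((i : ℝ) * j)) ^ k) :=
      Finset.sum_congr rfl fun k _ => by rw [mul_pow, mul_pow]; ring
    rw [e2, e3]; ring
  have h3 : ∑ i, ∑ j, x i * (A.map (powF α)) i j * x j =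
      t ^ m * (Ring.choose α m * (m.factorial : ℝ) ^ 2 +
        ∑ i : Fin n, ∑ j : Fin n, x i * x j * R ((i : ℝ) * j) t) := by
    simp only [h2, Finset.sum_add_distrib, mul_add, ← Finset.mul_sum]
    congr 1
    have : ∀ i : Fin n, ∑ j : Fin n, ∑ k ∈ Finset.range (m + 1), Ring.choose α k * t ^ k *
        ((x i * (i : ℝ) ^ k) * (x j * (j : ℝ) ^ k)) = ∑ k ∈ Finset.range (m + 1),
          Ring.choose α k * t ^ k * ((x i * (i : ℝ) ^ k) * ∑ j, (x j * (j : ℝ) ^ k)) := by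
      intro i
      rw [Finset.sum_comm]
      simp only [Finset.mul_sum]
    simp only [this]
    rw [Finset.sum_comm]
    simp only [← Finset.mul_sum, ← Finset.sum_mul]
    rw [Finset.sum_range_succ, Finset.sum_eq_zero, hxm]
    · ring
    · intro k hk
      rw [hx0 k (Finset.mem_range.1 hk)]; ring
  rw [h3] at h1
  have := mul_neg_of_pos_of_neg (pow_pos ht m) ht1
  linarith

lemma choose_neg (α : ℝ) (m : ℕ) (h : ∏ k ∈ Finset.range m, (α - k) < 0) :
    Ring.choose α m < 0 := by
  have h1 := Ring.descPochhammer_eq_factorial_smul_choose α m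
  rw [Polynomial.descPochhammer_smeval_eq_ascPochhammer,
    Polynomial.ascPochhammer_smeval_eq_eval, ← descPochhammer_eval_eq_ascPochhammer,
    descPochhammer_eval_eq_prod_range, nsmul_eq_mul] at h1
  rw [h1] at h
  by_contra hc
  push Not at hc
  have : (0 : ℝ) ≤ m.factorial * Ring.choose α m := mul_nonneg (by positivity) hc
  linarith

lemma zero_fails (n : ℕ) :
    ¬ ∀ A : Matrix (Fin (n + 3)) (Fin (n + 3)) ℝ, A.PosSemidef → (∀ i j, 0 ≤ A i j) →
        (A.map (powF 0)).PosSemidef := by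
  intro H
  let u : Fin (n + 3) → ℝ := fun i => if (i : ℕ) ≤ 1 then 1 else 0
  let v : Fin (n + 3) → ℝ := fun i => if (i : ℕ) = 0 then 0 else 1
  let A : Matrix (Fin (n + 3)) (Fin (n + 3)) ℝ := fun i j => u i * u j + v i * v j
  have hA : A.PosSemidef := by
    rw [psd_iff']
    refine ⟨fun i j => by simp only [A]; ring, fun y => ?_⟩
    have : ∑ i, ∑ j, y i * A i j * y j = (∑ i, y i * u i) ^ 2 + (∑ i, y i * v i) ^ 2 := by
      rw [sq, sq, Finset.sum_mul_sum, Finset.sum_mul_sum, ← Finset.sum_add_distrib]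
      refine Finset.sum_congr rfl fun i _ => ?_
      rw [← Finset.sum_add_distrib]
      refine Finset.sum_congr rfl fun j _ => ?_
      simp only [A]; ring
    rw [this]; positivity
  have hu : ∀ i, 0 ≤ u i := fun i => by simp only [u]; split_ifs <;> norm_num
  have hv : ∀ i, 0 ≤ v i := fun i => by simp only [v]; split_ifs <;> norm_num
  have h := H A hA fun i j => add_nonneg (mul_nonneg (hu i) (hu j)) (mul_nonneg (hv i) (hv j))
  let e : Fin 3 → Fin (n + 3) := fun i => ⟨i, by omega⟩
  have h1 := ((psd_iff' _).1 (h.submatrix e)).2 ![1, -1, 1]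
  have hu0 : u (e 0) = 1 := by simp [u, e]
  have hu1 : u (e 1) = 1 := by simp [u, e]
  have hu2 : u (e 2) = 0 := by simp [u, e]
  have hv0 : v (e 0) = 0 := by simp [v, e]
  have hv1 : v (e 1) = 1 := by simp [v, e]
  have hv2 : v (e 2) = 1 := by simp [v, e]
  have hm : ∀ i j, (A.map (powF 0)) i j = powF 0 (u i * u j + v i * v j) := fun i j => rfl
  simp only [Fin.sum_univ_three, Matrix.submatrix_apply, hm,
    hu0, hu1, hu2, hv0, hv1, hv2] at h1
  have hz : (![1, -1, 1] : Fin 3 → ℝ) 2 = 1 := rfl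
  rw [hz] at h1
  norm_num [powF] at h1

/-- `H_{K_n} = ℕ ∪ [n - 2, ∞)` (`ℕ` the positive integers). -/
theorem stmt2 (n : ℕ) (hn : 2 ≤ n) :
    {α : ℝ | ∀ A : Matrix (Fin n) (Fin n) ℝ, A.PosSemidef → (∀ i j, 0 ≤ A i j) →
        (A.map (powF α)).PosSemidef}
      = {α : ℝ | ∃ k : ℕ, 0 < k ∧ α = k} ∪ Set.Ici ((n : ℝ) - 2) := by
  ext α
  simp only [Set.mem_ofPred_eq, Set.mem_union, Set.mem_Ici]
  constructor
  · intro H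
    by_contra hc
    push Not at hc
    obtain ⟨hk, hlt⟩ := hc
    rcases lt_trichotomy α 0 with h0 | h0 | h0
    · exact not_preserve n 1 hn α (choose_neg α 1 (by simpa using h0)) H
    · subst h0
      have h3 : 3 ≤ n := by
        have : (2 : ℝ) < n := by linarith
        exact_mod_cast this
      obtain ⟨p, rfl⟩ := Nat.exists_eq_add_of_le' h3
      exact zero_fails p H
    · have hp1 : ((⌊α⌋₊ : ℕ) : ℝ) ≤ α := Nat.floor_le h0.le
      have hp2 : α < (⌊α⌋₊ : ℕ) + 1 := Nat.lt_floor_add_one α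
      set p := ⌊α⌋₊
      have hp3 : (p : ℝ) < α := by
        refine lt_of_le_of_ne hp1 fun h => ?_
        rcases Nat.eq_zero_or_pos p with hp | hp
        · rw [hp] at h; simp at h; linarith
        · exact hk p hp h.symm
      have hpn : p + 2 + 1 ≤ n := by
        have : (p : ℝ) + 2 < n := by linarith
        exact_mod_cast this
      refine not_preserve n (p + 2) hpn α (choose_neg α _ ?_) H
      rw [Finset.prod_range_succ]
      refine mul_neg_of_pos_of_neg (Finset.prod_pos fun k hk => ?_) (by push_cast; linarith)
      have : (k : ℝ) ≤ p := by exact_mod_cast Nat.lt_succ_iff.1 (Finset.mem_range.1 hk)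
      linarith
  · rintro (⟨k, hk, rfl⟩ | h) A hA hA0
    · obtain ⟨k, rfl⟩ := Nat.exists_eq_succ_of_ne_zero hk.ne'
      convert nat_power k A hA using 2
      ext y
      rw [powF_of_ne (by positivity), Real.rpow_natCast]
    · obtain ⟨p, rfl⟩ := Nat.exists_eq_add_of_le' hn
      exact forward p α (by push_cast at h; linarith) A hA hA0
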